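/- There exists an absolute constant C > 0 such that for all integers n ≥ m ≥ 2 the following holds: if g(x) = ∑_{k=0}^{m} ε_k cos(kx), where ε_0, …, ε_m are independent random variables taking values 0 and 1 each with probability 1/2, then E |E'_n(g) ∩ E^+(g) ∩ [n^{-0.1}, π]| ≤ C·n^{1.1}/m², where |·| denotes Lebesgue measure. -/

import Mathlib

open Real MeasureTheory

/-- `s(x) = 1 / (2 sin (x/2))`. -/
noncomputable def sfun (x : ℝ) : ℝ := (2 * Real.sin (x / 2))⁻¹

/-- The random polynomial `g ~ G_m` determined by the Bernoulli outcomes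
`e : Fin (m+1) → Bool`:  `g(x) = ∑_{k=0}^m ε_k cos(kx)`. -/
noncomputable def gB (m : ℕ) (e : Fin (m + 1) → Bool) : ℝ → ℝ :=
  fun x => ∑ k : Fin (m + 1), (if e k then (1 : ℝ) else 0) * Real.cos ((k : ℕ) * x)

/-- Fourier bound for a Rademacher-type sum over Boolean vectors. -/
theorem abs_sum_cos_le {ι : Type*} [Fintype ι] [DecidableEq ι] (θ : ι → ℝ) (p : ℝ) :
    |∑ e : ι → Bool, Real.cos ((∑ k, (if e k then (1 : ℝ) else 0) * θ k) - p)| ≤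
      2 ^ Fintype.card ι * ∏ k, |Real.cos (θ k / 2)| := by
  have factor (t : ℝ) : 1 + Complex.exp (t * Complex.I) =
      Complex.exp ((t / 2 : ℝ) * Complex.I) * (2 * Real.cos (t / 2) : ℝ) := by
    have h : Complex.exp (t * Complex.I) =
        Complex.exp ((t / 2 : ℝ) * Complex.I) * Complex.exp ((t / 2 : ℝ) * Complex.I) := by
      rw [← Complex.exp_add]; congr 1; push_cast; ring
    have h2 : Complex.exp ((t / 2 : ℝ) * Complex.I) * Complex.exp (-(t / 2 : ℝ) * Complex.I) = 1 := by
      rw [← Complex.exp_add]; simp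
    have h3 : ((2 * Real.cos (t / 2) : ℝ) : ℂ) =
        Complex.exp ((t / 2 : ℝ) * Complex.I) + Complex.exp (-(t / 2 : ℝ) * Complex.I) := by
      rw [← Complex.two_cos]; push_cast; rfl
    rw [h3, mul_add, h2, h, add_comm]
  have expand : ∑ e : ι → Bool,
      Complex.exp (((∑ k, (if e k then (1 : ℝ) else 0) * θ k : ℝ) : ℂ) * Complex.I) =
      ∏ k, (1 + Complex.exp (θ k * Complex.I)) := by
    have h (k : ι) : 1 + Complex.exp (θ k * Complex.I) =
        ∑ j : Bool, Complex.exp ((((if j then (1 : ℝ) else 0) * θ k : ℝ) : ℂ) * Complex.I) := by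
      simp [add_comm]
    simp_rw [h]
    rw [Finset.prod_univ_sum, Fintype.piFinset_univ]
    refine Finset.sum_congr rfl fun e _ => ?_
    rw [← Complex.exp_sum, ← Finset.sum_mul]
    push_cast
    rfl
  have re_eq : ∑ e : ι → Bool, Real.cos ((∑ k, (if e k then (1 : ℝ) else 0) * θ k) - p) =
      (Complex.exp (((-p : ℝ) : ℂ) * Complex.I) * ∏ k, (1 + Complex.exp (θ k * Complex.I))).re := by
    rw [← expand, Finset.mul_sum, Complex.re_sum]
    refine Finset.sum_congr rfl fun e _ => ?_
    rw [← Complex.exp_add, ← add_mul, ← Complex.ofReal_add, Complex.exp_ofReal_mul_I_re]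
    congr 1; ring
  rw [re_eq]
  refine (Complex.abs_re_le_norm _).trans ?_
  rw [norm_mul, Complex.norm_exp_ofReal_mul_I, one_mul, norm_prod]
  have hn (k : ι) : ‖1 + Complex.exp (θ k * Complex.I)‖ = 2 * |Real.cos (θ k / 2)| := by
    rw [factor, norm_mul, Complex.norm_exp_ofReal_mul_I, one_mul, Complex.norm_real,
      Real.norm_eq_abs, abs_mul, abs_two]
  simp_rw [hn]
  rw [Finset.prod_mul_distrib]
  simp

theorem abs_cos_half_le_exp {t : ℝ} (ht : |t| ≤ 2) :
    |Real.cos (t / 2)| ≤ Real.exp (-(t ^ 2 / 20)) := by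
  have ht' := abs_le.1 ht
  have hpi := Real.pi_gt_three
  have hpi4 := Real.pi_lt_d2
  have h0 : 0 ≤ Real.cos (t / 2) := Real.cos_nonneg_of_mem_Icc ⟨by linarith, by linarith⟩
  rw [abs_of_nonneg h0]
  have h1 : Real.cos (t / 2) ≤ 1 - 2 / π ^ 2 * (t / 2) ^ 2 :=
    Real.cos_le_one_sub_mul_cos_sq (abs_le.2 ⟨by linarith, by linarith⟩)
  have h2 : 1 / 5 ≤ 2 / π ^ 2 := by
    rw [div_le_div_iff₀ (by norm_num) (by positivity)]; nlinarith
  have h3 := Real.add_one_le_exp (-(t ^ 2 / 20))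
  nlinarith [mul_le_mul_of_nonneg_right h2 (sq_nonneg (t / 2))]

/-- The Fejér-type kernel `∫₀¹ (1 - t) cos(tu) dt = (1 - cos u) / u²`. -/
noncomputable def fejer (u : ℝ) : ℝ := ∫ t in (0 : ℝ)..1, (1 - t) * Real.cos (t * u)

theorem fejer_nonneg (u : ℝ) : 0 ≤ fejer u := by
  unfold fejer
  rcases eq_or_ne u 0 with rfl | hu
  · refine intervalIntegral.integral_nonneg zero_le_one fun t ht => ?_
    simpa using ht.2
  · have hd : ∀ t ∈ Set.uIcc (0 : ℝ) 1,
        HasDerivAt (fun t => (1 - t) * (Real.sin (t * u) / u) - Real.cos (t * u) / u ^ 2)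
          ((1 - t) * Real.cos (t * u)) t := by
      intro t _
      have hl : HasDerivAt (fun t => t * u) u t := by simpa using (hasDerivAt_id t).mul_const u
      have := (((hasDerivAt_id t).const_sub 1).mul (hl.sin.div_const u)).sub
        (hl.cos.div_const (u ^ 2))
      refine this.congr_deriv ?_
      simp only [id]
      field_simp
      ring
    rw [intervalIntegral.integral_eq_sub_of_hasDerivAt hd
      (Continuous.intervalIntegrable (by fun_prop) _ _)]
    have : (1 - (1 : ℝ)) * (Real.sin (1 * u) / u) - Real.cos (1 * u) / u ^ 2 -
        ((1 - 0) * (Real.sin (0 * u) / u) - Real.cos (0 * u) / u ^ 2) =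
        (1 - Real.cos u) / u ^ 2 := by
      simp; ring
    rw [this]
    exact div_nonneg (by linarith [Real.cos_le_one u]) (sq_nonneg u)

theorem one_fourth_le_fejer {u : ℝ} (hu : |u| ≤ 1) : 1 / 4 ≤ fejer u := by
  have h : ∫ t in (0 : ℝ)..1, (1 - t) * (1 / 2) = 1 / 4 := by
    rw [intervalIntegral.integral_mul_const, intervalIntegral.integral_sub (by simp) (by simp)]
    norm_num
  rw [← h, fejer]
  refine intervalIntegral.integral_mono_on zero_le_one
    (Continuous.intervalIntegrable (by fun_prop) _ _)
    (Continuous.intervalIntegrable (by fun_prop) _ _) fun t ht => ?_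
  refine mul_le_mul_of_nonneg_left ?_ (by linarith [ht.2])
  have h1 : |t * u| ≤ 1 := by
    rw [abs_mul, abs_of_nonneg ht.1]
    exact mul_le_one₀ ht.2 (abs_nonneg _) hu
  have h2 : (t * u) ^ 2 ≤ 1 := (sq_le_one_iff_abs_le_one _).2 h1
  linarith [Real.one_sub_sq_div_two_le_cos (x := t * u)]

theorem integral_exp_neg_mul_sq_le {b : ℝ} (hb : 0 < b) :
    ∫ t in (0 : ℝ)..1, Real.exp (-b * t ^ 2) ≤ √(π / b) := by
  rw [← integral_gaussian b, intervalIntegral.integral_of_le zero_le_one]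
  exact setIntegral_le_integral (integrable_exp_neg_mul_sq hb)
    (Filter.Eventually.of_forall fun _ => (Real.exp_pos _).le)

/-- Integrating a family of cosines with nonnegative coefficients against the kernel. -/
theorem sum_mul_fejer_le {ι : Type*} (s : Finset ι) (c u : ι → ℝ) {A b : ℝ} (hA : 0 ≤ A)
    (hb : 0 < b)
    (h : ∀ t ∈ Set.Icc (0 : ℝ) 1, ∑ i ∈ s, c i * Real.cos (t * u i) ≤ A * Real.exp (-b * t ^ 2)) :
    ∑ i ∈ s, c i * fejer (u i) ≤ A * √(π / b) := by
  have e1 : ∑ i ∈ s, c i * fejer (u i) =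
      ∫ t in (0 : ℝ)..1, (1 - t) * ∑ i ∈ s, c i * Real.cos (t * u i) := by
    simp_rw [fejer, ← intervalIntegral.integral_const_mul, Finset.mul_sum]
    rw [intervalIntegral.integral_finsetSum
      fun i _ => Continuous.intervalIntegrable (by fun_prop) _ _]
    refine Finset.sum_congr rfl fun i _ => ?_
    congr 1; ext t; ring
  rw [e1]
  refine le_trans ?_ (mul_le_mul_of_nonneg_left (integral_exp_neg_mul_sq_le hb) hA)
  rw [← intervalIntegral.integral_const_mul]
  refine intervalIntegral.integral_mono_on zero_le_one
    (Continuous.intervalIntegrable (by fun_prop) _ _)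
    (Continuous.intervalIntegrable (by fun_prop) _ _) fun t ht => ?_
  have hp : 0 ≤ A * Real.exp (-b * t ^ 2) := by positivity
  nlinarith [h t ht, ht.1, ht.2, mul_le_mul_of_nonneg_left (h t ht) (sub_nonneg.2 ht.2)]

/-- Two-dimensional small ball estimate for Boolean combinations of planar unit vectors. -/
theorem card_small_ball_le {ι : Type*} [Fintype ι] [DecidableEq ι] (a b : ι → ℝ)
    (hab : ∀ k, a k ^ 2 + b k ^ 2 ≤ 1) {c : ℝ} (hc : 0 < c)
    (hQ : ∀ ξ η : ℝ, c * (ξ ^ 2 + η ^ 2) ≤ ∑ k, (ξ * a k + η * b k) ^ 2)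
    (p q : ℝ) {R S : ℝ} (hR : 1 ≤ R) (hS : 1 ≤ S) :
    ((Finset.univ.filter fun e : ι → Bool =>
      |(∑ k, (if e k then (1 : ℝ) else 0) * a k) - p| ≤ R ∧
      |(∑ k, (if e k then (1 : ℝ) else 0) * b k) - q| ≤ S).card : ℝ) ≤
      320 * π / c * (R * S) * 2 ^ Fintype.card ι := by
  set N : ℝ := 2 ^ Fintype.card ι
  have hN : 0 ≤ N := by positivity
  have hR0 : 0 < R := by linarith
  have hS0 : 0 < S := by linarith
  let X (e : ι → Bool) : ℝ := ((∑ k, (if e k then (1 : ℝ) else 0) * a k) - p) / R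
  let Y (e : ι → Bool) : ℝ := ((∑ k, (if e k then (1 : ℝ) else 0) * b k) - q) / S
  have hprod (ξ η : ℝ) (hξ : |ξ| ≤ 1) (hη : |η| ≤ 1) :
      ∏ k, |Real.cos ((ξ * a k + η * b k) / 2)| ≤
        Real.exp (-(c / 20) * ξ ^ 2) * Real.exp (-(c / 20) * η ^ 2) := by
    have hle (k : ι) : |Real.cos ((ξ * a k + η * b k) / 2)| ≤
        Real.exp (-((ξ * a k + η * b k) ^ 2 / 20)) := by
      refine abs_cos_half_le_exp (abs_le_of_sq_le_sq ?_ (by norm_num))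
      have h1 := (sq_le_one_iff_abs_le_one _).2 hξ
      have h2 := (sq_le_one_iff_abs_le_one _).2 hη
      have h3 : (ξ * a k + η * b k) ^ 2 ≤ (ξ ^ 2 + η ^ 2) * (a k ^ 2 + b k ^ 2) := by
        nlinarith [sq_nonneg (ξ * b k - η * a k)]
      nlinarith [hab k, sq_nonneg ξ, sq_nonneg η]
    refine (Finset.prod_le_prod (fun _ _ => abs_nonneg _) fun k _ => hle k).trans ?_
    rw [← Real.exp_sum, ← Real.exp_add, Finset.sum_neg_distrib, ← Finset.sum_div]
    refine Real.exp_le_exp.2 ?_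
    linarith [hQ ξ η]
  have hsum (ξ η : ℝ) (hξ : |ξ| ≤ 1) (hη : |η| ≤ 1) (p' : ℝ) :
      ∑ e : ι → Bool, Real.cos ((∑ k, (if e k then (1 : ℝ) else 0) * (ξ * a k + η * b k)) - p') ≤
        N * (Real.exp (-(c / 20) * ξ ^ 2) * Real.exp (-(c / 20) * η ^ 2)) :=
    (le_abs_self _).trans ((abs_sum_cos_le _ p').trans
      (mul_le_mul_of_nonneg_left (hprod ξ η hξ hη) hN))
  have hunit {t T : ℝ} (ht : t ∈ Set.Icc (0 : ℝ) 1) (hT : 1 ≤ T) : |t / T| ≤ 1 := by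
    rw [abs_of_nonneg (div_nonneg ht.1 (by linarith))]
    exact (div_le_one (by linarith)).2 (ht.2.trans hT)
  have hlin (e : ι → Bool) (ξ η : ℝ) :
      ∑ k, (if e k then (1 : ℝ) else 0) * (ξ * a k + η * b k) =
      ξ * (∑ k, (if e k then (1 : ℝ) else 0) * a k) +
        η * ∑ k, (if e k then (1 : ℝ) else 0) * b k := by
    rw [Finset.mul_sum, Finset.mul_sum, ← Finset.sum_add_distrib]
    exact Finset.sum_congr rfl fun k _ => by ring
  have hcc : ∀ t ∈ Set.Icc (0 : ℝ) 1, ∀ r ∈ Set.Icc (0 : ℝ) 1,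
      ∑ e, Real.cos (t * X e) * Real.cos (r * Y e) ≤
        N * Real.exp (-(c / 20 / R ^ 2) * t ^ 2) * Real.exp (-(c / 20 / S ^ 2) * r ^ 2) := by
    intro t ht r hr
    have h1 := hsum (t / R) (r / S) (hunit ht hR) (hunit hr hS) (t / R * p + r / S * q)
    have h2 := hsum (t / R) (-(r / S)) (hunit ht hR) (by rw [abs_neg]; exact hunit hr hS)
      (t / R * p + -(r / S) * q)
    have h3 : ∑ e, Real.cos (t * X e) * Real.cos (r * Y e) =
        ((∑ e : ι → Bool, Real.cos ((∑ k, (if e k then (1 : ℝ) else 0) *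
          (t / R * a k + r / S * b k)) - (t / R * p + r / S * q))) +
        ∑ e : ι → Bool, Real.cos ((∑ k, (if e k then (1 : ℝ) else 0) *
          (t / R * a k + -(r / S) * b k)) - (t / R * p + -(r / S) * q))) / 2 := by
      rw [← Finset.sum_add_distrib, Finset.sum_div]
      refine Finset.sum_congr rfl fun e _ => ?_
      rw [hlin, hlin]
      have e1 (x y : ℝ) : t / R * x + r / S * y - (t / R * p + r / S * q) =
          t * ((x - p) / R) + r * ((y - q) / S) := by ring
      have e2 (x y : ℝ) : t / R * x + -(r / S) * y - (t / R * p + -(r / S) * q) =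
          t * ((x - p) / R) - r * ((y - q) / S) := by ring
      rw [e1, e2, Real.cos_add, Real.cos_sub]
      ring
    have e3 : -(c / 20 / R ^ 2) * t ^ 2 = -(c / 20) * (t / R) ^ 2 := by ring
    have e4 : -(c / 20 / S ^ 2) * r ^ 2 = -(c / 20) * (r / S) ^ 2 := by ring
    rw [neg_sq] at h2
    rw [h3, e3, e4, mul_assoc]
    linarith
  have hF : ∑ e, fejer (X e) * fejer (Y e) ≤
      N * √(π / (c / 20 / S ^ 2)) * √(π / (c / 20 / R ^ 2)) := by
    simp_rw [mul_comm (fejer (X _))]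
    refine sum_mul_fejer_le _ _ _ (by positivity) (by positivity) fun t ht => ?_
    simp_rw [mul_comm (fejer (Y _))]
    refine (sum_mul_fejer_le _ _ _ (A := N * Real.exp (-(c / 20 / R ^ 2) * t ^ 2))
      (b := c / 20 / S ^ 2) (by positivity) (by positivity) fun r hr => hcc t ht r hr).trans
      (le_of_eq (by ring))
  have hsqrt {T : ℝ} (hT : 0 < T) : √(π / (c / 20 / T ^ 2)) = T * √(20 * π / c) := by
    rw [show π / (c / 20 / T ^ 2) = T ^ 2 * (20 * π / c) by field_simp,
      Real.sqrt_mul (sq_nonneg T), Real.sqrt_sq hT.le]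
  have hcard : ((Finset.univ.filter fun e : ι → Bool =>
      |(∑ k, (if e k then (1 : ℝ) else 0) * a k) - p| ≤ R ∧
      |(∑ k, (if e k then (1 : ℝ) else 0) * b k) - q| ≤ S).card : ℝ) ≤
      16 * ∑ e, fejer (X e) * fejer (Y e) := by
    rw [Finset.card_filter, Nat.cast_sum, Finset.mul_sum]
    refine Finset.sum_le_sum fun e _ => ?_
    split_ifs with he
    · have h1 : 1 / 4 ≤ fejer (X e) := one_fourth_le_fejer <| by
        rw [abs_div, abs_of_pos hR0]; exact (div_le_one hR0).2 he.1
      have h2 : 1 / 4 ≤ fejer (Y e) := one_fourth_le_fejer <| by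
        rw [abs_div, abs_of_pos hS0]; exact (div_le_one hS0).2 he.2
      push_cast
      nlinarith
    · simpa using mul_nonneg (fejer_nonneg (X e)) (fejer_nonneg (Y e))
  refine hcard.trans ((mul_le_mul_of_nonneg_left hF (by norm_num)).trans (le_of_eq ?_))
  rw [hsqrt hS0, hsqrt hR0]
  have h : √(20 * π / c) * √(20 * π / c) = 20 * π / c := Real.mul_self_sqrt (by positivity)
  calc 16 * (N * (S * √(20 * π / c)) * (R * √(20 * π / c)))
      = 16 * N * S * R * (√(20 * π / c) * √(20 * π / c)) := by ring
    _ = _ := by rw [h]; ring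

theorem half_le_sin {y : ℝ} (h1 : π / 6 ≤ y) (h2 : y ≤ 5 * π / 6) : 1 / 2 ≤ Real.sin y := by
  rw [← Real.sin_pi_div_six]
  have hpi := Real.pi_pos
  rcases le_total y (π / 2) with h | h
  · exact Real.sin_le_sin_of_le_of_le_pi_div_two (by linarith) h h1
  · rw [← Real.sin_pi_sub y]
    exact Real.sin_le_sin_of_le_of_le_pi_div_two (by linarith) (by linarith) (by linarith)

theorem exists_shift_of_le_pi_div_two {m : ℕ} {x : ℝ} (hm : 20 ≤ m) (h1 : 32 / m ≤ x)
    (h2 : x ≤ π / 2) : ∃ d : ℕ, 8 * d ≤ m ∧ 1 / 2 ≤ |Real.sin (d * x)| := by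
  have hm' : (20 : ℝ) ≤ m := by exact_mod_cast hm
  have hm0 : (0 : ℝ) < m := by linarith
  have hx : 0 < x := lt_of_lt_of_le (by positivity) h1
  have hpi := Real.pi_lt_d2
  have hpi0 := Real.pi_pos
  have hlow : π / (6 * x) ≤ ⌈π / (6 * x)⌉₊ := Nat.le_ceil _
  have hup : (⌈π / (6 * x)⌉₊ : ℝ) < π / (6 * x) + 1 := Nat.ceil_lt_add_one (by positivity)
  have hmul : π / (6 * x) * x = π / 6 := by field_simp
  refine ⟨⌈π / (6 * x)⌉₊, ?_, ?_⟩
  · have h32 : 32 ≤ m * x := by rwa [div_le_iff₀' hm0] at h1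
    have hb : π / (6 * x) ≤ m / 40 := by
      rw [div_le_div_iff₀ (by positivity) (by norm_num)]
      nlinarith
    have : (8 * ⌈π / (6 * x)⌉₊ : ℝ) ≤ m := by linarith
    exact_mod_cast this
  · refine (half_le_sin ?_ ?_).trans (le_abs_self _)
    · rw [← hmul]; exact mul_le_mul_of_nonneg_right hlow hx.le
    · nlinarith [mul_le_mul_of_nonneg_right hup.le hx.le]

theorem exists_shift {m : ℕ} {x : ℝ} (hm : 20 ≤ m) (h1 : 32 / m ≤ x)
    (h2 : x ≤ π - 32 / m) : ∃ d : ℕ, 8 * d ≤ m ∧ 1 / 2 ≤ |Real.sin (d * x)| := by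
  rcases le_total x (π / 2) with h | h
  · exact exists_shift_of_le_pi_div_two hm h1 h
  · obtain ⟨d, hd, hs⟩ := exists_shift_of_le_pi_div_two (x := π - x) hm (by linarith) (by linarith)
    refine ⟨d, hd, hs.trans_eq ?_⟩
    rw [mul_sub, Real.sin_nat_mul_pi_sub, abs_neg, abs_mul, abs_pow, abs_neg, abs_one, one_pow,
      one_mul]

/-- Two planar vectors of norm at most one with non-negligible determinant control the norm. -/
theorem norm_sq_le_of_det {a b a' b' : ℝ} (h : a ^ 2 + b ^ 2 ≤ 1) (h' : a' ^ 2 + b' ^ 2 ≤ 1)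
    (hdet : 1 / 8 ≤ |a * b' - a' * b|) (ξ η : ℝ) :
    (ξ ^ 2 + η ^ 2) / 128 ≤ (ξ * a + η * b) ^ 2 + (ξ * a' + η * b') ^ 2 := by
  set p := ξ * a + η * b with hp
  set q := ξ * a' + η * b' with hq
  have h1 : (a * b' - a' * b) ^ 2 * (ξ ^ 2 + η ^ 2) = (b' * p - b * q) ^ 2 + (a * q - a' * p) ^ 2 := by
    rw [hp, hq]; ring
  have h2 : (1 / 8) ^ 2 ≤ (a * b' - a' * b) ^ 2 := by
    rw [← sq_abs (a * b' - a' * b)]; exact pow_le_pow_left₀ (by norm_num) hdet 2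
  have h3 : (b' * p - b * q) ^ 2 + (a * q - a' * p) ^ 2 ≤
      (a ^ 2 + b ^ 2 + (a' ^ 2 + b' ^ 2)) * (p ^ 2 + q ^ 2) := by
    nlinarith [sq_nonneg (b' * q + b * p), sq_nonneg (a' * q + a * p)]
  have h4 : (a ^ 2 + b ^ 2 + (a' ^ 2 + b' ^ 2)) * (p ^ 2 + q ^ 2) ≤ 2 * (p ^ 2 + q ^ 2) :=
    mul_le_mul_of_nonneg_right (by linarith) (by positivity)
  have h5 := mul_le_mul_of_nonneg_right h2 (add_nonneg (sq_nonneg ξ) (sq_nonneg η))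
  linarith

theorem cos_sq_add_sq_le_one (m k : ℕ) (hk : k ≤ m) (x : ℝ) :
    Real.cos (k * x) ^ 2 + (-(k / m * Real.sin (k * x))) ^ 2 ≤ 1 := by
  have h : ((k : ℝ) / m) ^ 2 ≤ 1 :=
    pow_le_one₀ (by positivity) (div_le_one_of_le₀ (by exact_mod_cast hk) (by positivity))
  rw [neg_sq, mul_pow]
  nlinarith [Real.sin_sq_add_cos_sq (k * x), sq_nonneg (Real.sin (k * x))]

theorem le_abs_det {m k d : ℕ} {x : ℝ} (hm : 0 < m) (hk : m ≤ 2 * k) (hd : 8 * d ≤ m)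
    (hs : 1 / 2 ≤ |Real.sin (d * x)|) :
    1 / 8 ≤ |Real.cos (k * x) * (-((k + d : ℕ) / m * Real.sin ((k + d : ℕ) * x))) -
      Real.cos ((k + d : ℕ) * x) * (-(k / m * Real.sin (k * x)))| := by
  have hm0 : (0 : ℝ) < m := by exact_mod_cast hm
  have hk' : (m : ℝ) ≤ 2 * k := by exact_mod_cast hk
  have hd' : 8 * (d : ℝ) ≤ m := by exact_mod_cast hd
  have hdx : Real.sin (d * x) = Real.sin ((k + d : ℕ) * x) * Real.cos (k * x) -
      Real.cos ((k + d : ℕ) * x) * Real.sin (k * x) := by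
    rw [← Real.sin_sub]; congr 1; push_cast; ring
  have heq : Real.cos (k * x) * (-((k + d : ℕ) / m * Real.sin ((k + d : ℕ) * x))) -
      Real.cos ((k + d : ℕ) * x) * (-(k / m * Real.sin (k * x))) =
      -(((k + d : ℕ) / m * Real.sin (d * x)) -
        -(d / m * (Real.cos ((k + d : ℕ) * x) * Real.sin (k * x)))) := by
    rw [hdx]; push_cast; ring
  rw [heq, abs_neg]
  refine le_trans ?_ (abs_sub_abs_le_abs_sub _ _)
  rw [abs_neg, abs_mul, abs_mul, abs_mul, abs_of_nonneg (by positivity : (0 : ℝ) ≤ d / m),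
    abs_of_nonneg (by positivity : (0 : ℝ) ≤ (k + d : ℕ) / m)]
  have h1 : (1 : ℝ) / 2 ≤ (k + d : ℕ) / m := by
    rw [div_le_div_iff₀ (by norm_num) hm0]; push_cast; linarith [(Nat.cast_nonneg d : (0 : ℝ) ≤ d)]
  have h2 : (d : ℝ) / m ≤ 1 / 8 := by
    rw [div_le_div_iff₀ hm0 (by norm_num)]; linarith
  have h3 : |Real.cos ((k + d : ℕ) * x)| * |Real.sin (k * x)| ≤ 1 :=
    mul_le_one₀ (Real.abs_cos_le_one _) (abs_nonneg _) (Real.abs_sin_le_one _)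
  have h4 := mul_le_mul h1 hs (by norm_num) (by positivity)
  have h5 := mul_le_mul h2 h3 (by positivity) (by norm_num)
  linarith

theorem quadratic_form_lower_bound {m : ℕ} {x : ℝ} (hm : 20 ≤ m) (h1 : 32 / m ≤ x)
    (h2 : x ≤ π - 32 / m) (ξ η : ℝ) :
    (m / 1024 : ℝ) * (ξ ^ 2 + η ^ 2) ≤ ∑ k : Fin (m + 1),
      (ξ * Real.cos ((k : ℕ) * x) + η * (-((k : ℕ) / m * Real.sin ((k : ℕ) * x)))) ^ 2 := by
  obtain ⟨d, hd, hs⟩ := exists_shift hm h1 h2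
  let f (k : ℕ) : ℝ := (ξ * Real.cos (k * x) + η * (-(k / m * Real.sin (k * x)))) ^ 2
  have hf (k : ℕ) : 0 ≤ f k := sq_nonneg _
  change _ ≤ ∑ k : Fin (m + 1), f k
  rw [Fin.sum_univ_eq_sum_range f]
  let T := Finset.Icc ((m + 1) / 2) (m - d)
  have hT {k : ℕ} (hk : k ∈ T) : m ≤ 2 * k ∧ k + d ≤ m := by
    have := Finset.mem_Icc.1 hk; omega
  have hsum1 : ∑ k ∈ T, f k ≤ ∑ k ∈ Finset.range (m + 1), f k :=
    Finset.sum_le_sum_of_subset_of_nonneg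
      (fun k hk => Finset.mem_range.2 (by have := hT hk; omega)) fun _ _ _ => hf _
  have hsum2 : ∑ k ∈ T, f (k + d) ≤ ∑ k ∈ Finset.range (m + 1), f k := by
    rw [← Finset.sum_image (f := f) (g := fun k => k + d) fun _ _ _ _ h => Nat.add_right_cancel h]
    refine Finset.sum_le_sum_of_subset_of_nonneg (fun k hk => ?_) fun _ _ _ => hf _
    obtain ⟨j, hj, rfl⟩ := Finset.mem_image.1 hk
    exact Finset.mem_range.2 (by have := hT hj; omega)
  have hpair : ∑ k ∈ T, (ξ ^ 2 + η ^ 2) / 128 ≤ ∑ k ∈ T, (f k + f (k + d)) := by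
    refine Finset.sum_le_sum fun k hk => ?_
    obtain ⟨hk1, hk2⟩ := hT hk
    exact norm_sq_le_of_det (cos_sq_add_sq_le_one m k (by omega) x)
      (cos_sq_add_sq_le_one m (k + d) hk2 x) (le_abs_det (by omega) hk1 hd hs) ξ η
  rw [Finset.sum_const, nsmul_eq_mul, Finset.sum_add_distrib] at hpair
  have hcard : (m : ℝ) ≤ 4 * T.card := by
    have : m ≤ 4 * T.card := by simp only [T, Nat.card_Icc]; omega
    exact_mod_cast this
  nlinarith [mul_le_mul_of_nonneg_right hcard (add_nonneg (sq_nonneg ξ) (sq_nonneg η))]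

theorem hasDerivAt_gB (m : ℕ) (e : Fin (m + 1) → Bool) (x : ℝ) :
    HasDerivAt (gB m e)
      (∑ k : Fin (m + 1), (if e k then (1 : ℝ) else 0) *
        (-((k : ℕ) * Real.sin ((k : ℕ) * x)))) x := by
  unfold gB
  refine HasDerivAt.fun_sum fun k _ => HasDerivAt.const_mul _ ?_
  have hl : HasDerivAt (fun y : ℝ => ((k : ℕ) : ℝ) * y) (k : ℕ) x := by
    simpa using (hasDerivAt_id x).const_mul ((k : ℕ) : ℝ)
  exact hl.cos.congr_deriv (by ring)

theorem sfun_bounds {x : ℝ} (h0 : 0 < x) (hpi : x < π) :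
    1 / 2 ≤ sfun x ∧ sfun x ≤ π / 2 * x⁻¹ := by
  have hs : 0 < Real.sin (x / 2) := Real.sin_pos_of_pos_of_lt_pi (by linarith) (by linarith)
  have hj : 2 / π * (x / 2) ≤ Real.sin (x / 2) := Real.mul_le_sin (by linarith) (by linarith)
  unfold sfun
  constructor
  · rw [one_div]
    exact inv_anti₀ (by positivity) (by linarith [Real.sin_le_one (x / 2)])
  · have : π / 2 * x⁻¹ = (2 * (2 / π * (x / 2)))⁻¹ := by
      have := Real.pi_ne_zero
      field_simp
    rw [this]
    exact inv_anti₀ (by have := Real.pi_pos; positivity) (by linarith)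

/-- The pointwise small ball estimate, away from the endpoints of `[0, π]`. -/
theorem card_outcomes_le {m n : ℕ} {x : ℝ} (hm : 20 ≤ m) (hn : m ≤ n) (h1 : 32 / m ≤ x)
    (h2 : x ≤ π - 32 / m) :
    ((Finset.univ.filter fun e : Fin (m + 1) → Bool =>
      |deriv (gB m e) x| ≤ 2 ^ (7 : ℕ) * (n : ℝ) * sfun x ∧
      |gB m e x - 1 / 2| ≤ 4 * sfun x).card : ℝ) ≤
      2 ^ (m + 1) * (2 ^ 23 * 5 * π ^ 3) * (n / m ^ 2) * x ^ (-2 : ℝ) := by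
  have hm0 : (0 : ℝ) < m := by exact_mod_cast (by omega : 0 < m)
  have hx0 : 0 < x := lt_of_lt_of_le (by positivity) h1
  have hxpi : x < π := h2.trans_lt (sub_lt_self _ (by positivity))
  obtain ⟨hs1, hs2⟩ := sfun_bounds hx0 hxpi
  have hnm : 1 ≤ (n : ℝ) / m := by
    rw [one_le_div hm0]; exact_mod_cast hn
  have key := card_small_ball_le (fun k : Fin (m + 1) => Real.cos ((k : ℕ) * x))
    (fun k => -((k : ℕ) / m * Real.sin ((k : ℕ) * x)))
    (fun k => cos_sq_add_sq_le_one m k (by omega) x) (c := m / 1024) (by positivity)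
    (quadratic_form_lower_bound hm h1 h2) (1 / 2) 0 (R := 4 * sfun x)
    (S := 128 * (n / m) * sfun x) (by linarith) (by nlinarith)
  have hsub : (Finset.univ.filter fun e : Fin (m + 1) → Bool =>
      |deriv (gB m e) x| ≤ 2 ^ (7 : ℕ) * (n : ℝ) * sfun x ∧
      |gB m e x - 1 / 2| ≤ 4 * sfun x) ⊆ Finset.univ.filter fun e : Fin (m + 1) → Bool =>
      |(∑ k, (if e k then (1 : ℝ) else 0) * Real.cos ((k : ℕ) * x)) - 1 / 2| ≤ 4 * sfun x ∧
      |(∑ k, (if e k then (1 : ℝ) else 0) * (-((k : ℕ) / m * Real.sin ((k : ℕ) * x)))) - 0| ≤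
        128 * (n / m) * sfun x := by
    refine Finset.monotone_filter_right _ fun e _ he => ⟨he.2, ?_⟩
    have hd := he.1
    rw [(hasDerivAt_gB m e x).deriv] at hd
    have : (∑ k : Fin (m + 1), (if e k then (1 : ℝ) else 0) *
        (-((k : ℕ) / m * Real.sin ((k : ℕ) * x)))) =
        (∑ k : Fin (m + 1), (if e k then (1 : ℝ) else 0) *
          (-((k : ℕ) * Real.sin ((k : ℕ) * x)))) / m := by
      rw [Finset.sum_div]
      exact Finset.sum_congr rfl fun k _ => by ring
    rw [sub_zero, this, abs_div, abs_of_pos hm0, div_le_iff₀ hm0]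
    refine hd.trans (le_of_eq ?_)
    field_simp
    ring
  refine (Nat.cast_le.2 (Finset.card_le_card hsub)).trans (key.trans ?_)
  have hsq : sfun x ^ 2 ≤ π ^ 2 / 4 * x ^ (-2 : ℝ) := by
    rw [Real.rpow_neg hx0.le, Real.rpow_two]
    refine (pow_le_pow_left₀ (by linarith) hs2 2).trans_eq ?_
    rw [mul_pow, inv_pow]; ring
  rw [Fintype.card_fin]
  calc 320 * π / (m / 1024) * (4 * sfun x * (128 * (n / m) * sfun x)) * 2 ^ (m + 1)
      = 2 ^ (m + 1) * (320 * π * 1024 * 512) * (n / m ^ 2) * sfun x ^ 2 := by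
        field_simp; ring
    _ ≤ 2 ^ (m + 1) * (320 * π * 1024 * 512) * (n / m ^ 2) * (π ^ 2 / 4 * x ^ (-2 : ℝ)) := by
        gcongr
    _ = _ := by ring

theorem sum_measureReal_inter_le {ι : Type*} [Fintype ι] (A : ι → Set ℝ)
    (hA : ∀ e, MeasurableSet (A e)) {J : Set ℝ} (hJ : MeasurableSet J) {L K : ℝ} (hL : 0 < L)
    (hK : 0 ≤ K) (hJL : J ⊆ Set.Ioi L) (hJfin : volume J ≠ ⊤)
    (h : ∀ x ∈ J, ∑ e, (A e).indicator (fun _ => (1 : ℝ)) x ≤ K * x ^ (-2 : ℝ)) :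
    ∑ e, volume.real (J ∩ A e) ≤ K * L⁻¹ := by
  have hint : IntegrableOn (fun x : ℝ => K * x ^ (-2 : ℝ)) (Set.Ioi L) :=
    (integrableOn_Ioi_rpow_of_lt (by norm_num) hL).const_mul K
  have hind (e : ι) : IntegrableOn ((A e).indicator fun _ => (1 : ℝ)) J :=
    (integrableOn_const hJfin).indicator (hA e)
  calc ∑ e, volume.real (J ∩ A e)
      = ∫ x in J, ∑ e, (A e).indicator (fun _ => (1 : ℝ)) x := by
        rw [integral_finsetSum _ fun e _ => hind e]
        refine Finset.sum_congr rfl fun e _ => ?_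
        rw [setIntegral_indicator (hA e), setIntegral_const, smul_eq_mul, mul_one]
    _ ≤ ∫ x in J, K * x ^ (-2 : ℝ) :=
        setIntegral_mono_on (integrable_finsetSum _ fun e _ => hind e) (hint.mono_set hJL) hJ h
    _ ≤ ∫ x in Set.Ioi L, K * x ^ (-2 : ℝ) := by
        refine setIntegral_mono_set hint ?_ hJL.eventuallyLE
        filter_upwards [ae_restrict_mem measurableSet_Ioi] with x hx
        have : 0 < x := hL.trans hx
        positivity
    _ = K * L⁻¹ := by
        rw [integral_const_mul, integral_Ioi_rpow_of_lt (by norm_num) hL]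
        norm_num [Real.rpow_neg_one]

theorem measurableSet_small_values (m n : ℕ) (e : Fin (m + 1) → Bool) :
    MeasurableSet ({x : ℝ | |deriv (gB m e) x| ≤ 2 ^ (7 : ℕ) * (n : ℝ) * sfun x} ∩
      {x : ℝ | |gB m e x - 1 / 2| ≤ 4 * sfun x}) := by
  have hs : Measurable sfun := by unfold sfun; fun_prop
  have hg : Measurable (gB m e) := by unfold gB; fun_prop
  exact (measurableSet_le (continuous_abs.measurable.comp (measurable_deriv _))
    (hs.const_mul _)).inter
    (measurableSet_le (continuous_abs.measurable.comp (hg.sub_const _)) (hs.const_mul _))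

/-- There is an absolute constant `C > 0` such that for all `n ≥ m ≥ 2`: if `g ~ G_m` then
`E |E'_n(g) ∩ E⁺(g) ∩ [n^{-0.1}, π]| ≤ C n^{1.1} / m²`, where
`E'_n(g) = {x : |g'(x)| ≤ 2⁷ n s(x)}`, `E⁺(g) = {x : |g(x) - 1/2| ≤ 4 s(x)}`, `|·|` is
Lebesgue measure and the expectation is the average over all `2^(m+1)` Bernoulli
outcomes. -/
theorem stmt19 :
    ∃ C : ℝ, 0 < C ∧ ∀ m n : ℕ, 2 ≤ m → m ≤ n →
      (∑ e : Fin (m + 1) → Bool,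
        (volume ({x : ℝ | |deriv (gB m e) x| ≤ 2 ^ (7 : ℕ) * (n : ℝ) * sfun x} ∩
          {x : ℝ | |gB m e x - 1 / 2| ≤ 4 * sfun x} ∩
          Set.Icc ((n : ℝ) ^ (-(0.1 : ℝ))) π)).toReal) / 2 ^ (m + 1) ≤
        C * (n : ℝ) ^ (1.1 : ℝ) / (m : ℝ) ^ 2 := by
  refine ⟨64 + 2 ^ 23 * 5 * π ^ 3, by positivity, fun m n hm hmn => ?_⟩
  have hm0 : (0 : ℝ) < m := by exact_mod_cast (by omega : 0 < m)
  have hmn' : (m : ℝ) ≤ n := by exact_mod_cast hmn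
  have hn1 : (1 : ℝ) ≤ n := by exact_mod_cast (by omega : 1 ≤ n)
  have hn0 : (0 : ℝ) < n := by linarith
  set L : ℝ := (n : ℝ) ^ (-(0.1 : ℝ)) with hLdef
  have hL : 0 < L := Real.rpow_pos_of_pos hn0 _
  have hn11 : (n : ℝ) * L⁻¹ = (n : ℝ) ^ (1.1 : ℝ) := by
    rw [hLdef, ← Real.rpow_neg hn0.le, ← Real.rpow_one_add' hn0.le (by norm_num)]
    norm_num
  have hnle : (n : ℝ) ≤ (n : ℝ) ^ (1.1 : ℝ) := Real.self_le_rpow_of_one_le hn1 (by norm_num)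
  let A (e : Fin (m + 1) → Bool) : Set ℝ :=
    {x : ℝ | |deriv (gB m e) x| ≤ 2 ^ (7 : ℕ) * (n : ℝ) * sfun x} ∩
      {x : ℝ | |gB m e x - 1 / 2| ≤ 4 * sfun x}
  let J : Set ℝ := Set.Ioc L π ∩ Set.Icc (32 / m) (π - 32 / m)
  have hJfin : volume J ≠ ⊤ :=
    ((measure_mono Set.inter_subset_left).trans_lt measure_Ioc_lt_top).ne
  have hsplit (e : Fin (m + 1) → Bool) :
      (volume (A e ∩ Set.Icc L π)).toReal ≤ volume.real (J ∩ A e) + 64 / m := by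
    have hcover : A e ∩ Set.Icc L π ⊆
        (J ∩ A e) ∪ (Set.Icc 0 (32 / m) ∪ Set.Icc (π - 32 / m) π ∪ {L}) := by
      rintro x ⟨hxA, hx1, hx2⟩
      by_cases hxL : x = L
      · exact Or.inr (Or.inr hxL)
      by_cases h1 : x ≤ 32 / m
      · exact Or.inr (Or.inl (Or.inl ⟨hL.le.trans hx1, h1⟩))
      by_cases h2 : π - 32 / m ≤ x
      · exact Or.inr (Or.inl (Or.inr ⟨h2, hx2⟩))
      · exact Or.inl ⟨⟨⟨lt_of_le_of_ne hx1 (Ne.symm hxL), hx2⟩, (not_le.1 h1).le,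
          (not_le.1 h2).le⟩, hxA⟩
    have hfin : volume ((J ∩ A e) ∪ (Set.Icc 0 (32 / m) ∪ Set.Icc (π - 32 / m) π ∪ {L})) ≠ ⊤ := by
      refine measure_union_ne_top ((measure_mono Set.inter_subset_left).trans_lt
        hJfin.lt_top).ne (measure_union_ne_top (measure_union_ne_top ?_ ?_) ?_) <;> simp
    refine (measureReal_mono hcover hfin).trans ((measureReal_union_le _ _).trans ?_)
    refine add_le_add le_rfl ((measureReal_union_le _ _).trans ?_)
    refine (add_le_add (measureReal_union_le _ _) le_rfl).trans (le_of_eq ?_)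
    have h32 : (0 : ℝ) ≤ 32 / m := by positivity
    rw [Real.volume_real_Icc_of_le h32, Real.volume_real_Icc_of_le (by linarith)]
    simp only [measureReal_def, Real.volume_singleton, ENNReal.toReal_zero]
    ring
  have hmain : ∑ e, volume.real (J ∩ A e) ≤
      2 ^ (m + 1) * (2 ^ 23 * 5 * π ^ 3) * (n / m ^ 2) * L⁻¹ := by
    refine sum_measureReal_inter_le A (measurableSet_small_values m n)
      (measurableSet_Ioc.inter measurableSet_Icc) hL (by positivity) (fun x hx => hx.1.1) hJfin
      fun x hx => ?_
    obtain ⟨-, hx1, hx2⟩ := hx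
    have hm20 : 20 ≤ m := by
      have h : 32 / (m : ℝ) * 2 ≤ π := by linarith
      rw [div_mul_eq_mul_div, div_le_iff₀ hm0] at h
      have : (20 : ℝ) ≤ m := by nlinarith [Real.pi_lt_d2]
      exact_mod_cast this
    have hx0 : 0 < x := lt_of_lt_of_le (by positivity) hx1
    classical
    have hcount : ∑ e, (A e).indicator (fun _ => (1 : ℝ)) x =
        ((Finset.univ.filter fun e : Fin (m + 1) → Bool =>
          |deriv (gB m e) x| ≤ 2 ^ (7 : ℕ) * (n : ℝ) * sfun x ∧
          |gB m e x - 1 / 2| ≤ 4 * sfun x).card : ℝ) := by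
      rw [Finset.card_filter, Nat.cast_sum]
      refine Finset.sum_congr rfl fun e _ => ?_
      simp [A, Set.indicator_apply]
    rw [hcount]
    convert card_outcomes_le hm20 hmn hx1 hx2 using 1
  have htotal : ∑ e : Fin (m + 1) → Bool, (volume (A e ∩ Set.Icc L π)).toReal ≤
      2 ^ (m + 1) * (2 ^ 23 * 5 * π ^ 3) * (n / m ^ 2) * L⁻¹ + 2 ^ (m + 1) * (64 / m) := by
    refine (Finset.sum_le_sum fun e _ => hsplit e).trans ?_
    rw [Finset.sum_add_distrib]
    refine add_le_add hmain (le_of_eq ?_)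
    simp
  rw [div_le_iff₀ (by positivity)]
  refine htotal.trans ?_
  have h64 : (64 : ℝ) / m ≤ 64 * ((n : ℝ) ^ (1.1 : ℝ) / m ^ 2) := by
    rw [← mul_div_assoc, div_le_div_iff₀ hm0 (by positivity)]
    nlinarith
  calc 2 ^ (m + 1) * (2 ^ 23 * 5 * π ^ 3) * (n / m ^ 2) * L⁻¹ + 2 ^ (m + 1) * (64 / m)
      = 2 ^ (m + 1) * (2 ^ 23 * 5 * π ^ 3) * (n * L⁻¹ / m ^ 2) + 2 ^ (m + 1) * (64 / m) := by ring
    _ ≤ 2 ^ (m + 1) * (2 ^ 23 * 5 * π ^ 3) * ((n : ℝ) ^ (1.1 : ℝ) / m ^ 2) +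
        2 ^ (m + 1) * (64 * ((n : ℝ) ^ (1.1 : ℝ) / m ^ 2)) := by
        rw [hn11]; gcongr
    _ = _ := by ring
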